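/- For any finite sets $A$ and $B$ of real numbers, there exist finite sets $A'$ and $B'$ of integers with $|A'| = |A|$ and $|B'| = |B|$ such that $T(A', B', A' \cup B') = T(A, B, A \cup B)$ and $T(A', -A', A') = T(A, -A, A)$. -/

import Mathlib

open Pointwise

/-- `T A B C` is the number of triples `(a,b,c) ∈ A × B × C` with `a + b = 2c`. -/
noncomputable def T (A B C : Finset ℝ) : ℕ :=
  ((A ×ˢ B ×ˢ C).filter (fun p => p.1 + p.2.1 = 2 * p.2.2)).card

/-- The canonical embedding of the integers into the reals, as a `Finset.map` embedding. -/
def intCastEmb : ℤ ↪ ℝ := ⟨Int.cast, Int.cast_injective⟩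

theorem T_image (A B C : Finset ℝ) (ψ : ℝ → ℝ) (hA : Set.InjOn ψ A) (hB : Set.InjOn ψ B)
    (hC : Set.InjOn ψ C)
    (h : ∀ a ∈ A, ∀ b ∈ B, ∀ c ∈ C, (ψ a + ψ b = 2 * ψ c ↔ a + b = 2 * c)) :
    T (A.image ψ) (B.image ψ) (C.image ψ) = T A B C := by
  unfold T
  symm
  refine Finset.card_bij (fun p _ => (ψ p.1, ψ p.2.1, ψ p.2.2)) ?_ ?_ ?_
  · rintro ⟨a, b, c⟩ hp
    simp only [Finset.mem_filter, Finset.mem_product] at hp ⊢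
    obtain ⟨⟨ha, hb, hc⟩, he⟩ := hp
    exact ⟨⟨Finset.mem_image_of_mem _ ha, Finset.mem_image_of_mem _ hb,
      Finset.mem_image_of_mem _ hc⟩, (h a ha b hb c hc).2 he⟩
  · rintro ⟨a, b, c⟩ hp ⟨a', b', c'⟩ hp' he
    simp only [Finset.mem_filter, Finset.mem_product] at hp hp'
    simp only [Prod.mk.injEq] at he ⊢
    exact ⟨hA hp.1.1 hp'.1.1 he.1, hB hp.1.2.1 hp'.1.2.1 he.2.1, hC hp.1.2.2 hp'.1.2.2 he.2.2⟩
  · rintro ⟨x, y, z⟩ hp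
    simp only [Finset.mem_filter, Finset.mem_product, Finset.mem_image] at hp
    obtain ⟨⟨⟨a, ha, rfl⟩, ⟨b, hb, rfl⟩, ⟨c, hc, rfl⟩⟩, he⟩ := hp
    refine ⟨(a, b, c), ?_, rfl⟩
    simp only [Finset.mem_filter, Finset.mem_product]
    exact ⟨⟨ha, hb, hc⟩, (h a ha b hb c hc).1 he⟩

theorem exists_good (U S : Finset ℝ) : ∃ g : ℝ →ₗ[ℚ] ℚ,
    (∀ s ∈ S, g s = 0 → s = 0) ∧ (∀ u ∈ U, ∃ z : ℤ, g u = z) := by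
  classical
  obtain ⟨f, hf⟩ := Module.exists_dual_forall_apply_ne_zero (K := ℚ) (M := ℝ)
    (fun s : {s // s ∈ S.filter (· ≠ 0)} => (s : ℝ))
    (fun s => (Finset.mem_filter.1 s.2).2)
  obtain ⟨N, hN⟩ := IsLocalization.exist_integer_multiples_of_finset (nonZeroDivisors ℤ)
    (U.image f)
  have hN0 : ((N : ℤ) : ℚ) ≠ 0 := by
    exact_mod_cast nonZeroDivisors.ne_zero N.2
  refine ⟨((N : ℤ) : ℚ) • f, ?_, ?_⟩
  · intro s hs h0
    by_contra hne
    refine hf ⟨s, Finset.mem_filter.2 ⟨hs, hne⟩⟩ ?_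
    simpa [hN0] using h0
  · intro u hu
    obtain ⟨z, hz⟩ := hN (f u) (Finset.mem_image_of_mem _ hu)
    refine ⟨z, ?_⟩
    simp at hz ⊢
    exact hz.symm

/-- For any finite sets `A` and `B` of real numbers, there exist finite sets `A'` and `B'`
of integers with `|A'| = |A|`, `|B'| = |B|`, such that `T(A',B',A'∪B') = T(A,B,A∪B)`
and `T(A',-A',A') = T(A,-A,A)`. -/
theorem stmt3 (A B : Finset ℝ) :
    ∃ A' B' : Finset ℤ, A'.card = A.card ∧ B'.card = B.card ∧
      T (A'.map intCastEmb) (B'.map intCastEmb) ((A' ∪ B').map intCastEmb)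
        = T A B (A ∪ B) ∧
      T (A'.map intCastEmb) ((-A').map intCastEmb) (A'.map intCastEmb)
        = T A (-A) A := by
  classical
  set U := A ∪ B with hU
  set V := U ∪ -U with hV
  obtain ⟨g, hg, hz⟩ := exists_good U (((V + V) - (V + V)) ∪ (V - V))
  have hUV : ∀ u ∈ U, u ∈ V := fun u hu => Finset.mem_union_left _ hu
  have hAU : ∀ u ∈ A, u ∈ U := fun u hu => Finset.mem_union_left _ hu
  have hBU : ∀ u ∈ B, u ∈ U := fun u hu => Finset.mem_union_right _ hu
  have hAV : ∀ u ∈ -A, u ∈ V := fun u hu => by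
    refine Finset.mem_union_right _ ?_
    rw [Finset.mem_neg'] at hu ⊢
    exact hAU _ hu
  let ψ : ℝ → ℝ := fun x => ((g x : ℚ) : ℝ)
  let φ : ℝ → ℤ := fun x => ⌊g x⌋
  have hφ : ∀ u ∈ U, ((φ u : ℤ) : ℝ) = ψ u := by
    intro u hu
    obtain ⟨z, h⟩ := hz u hu
    simp [φ, ψ, h]
  have hinj : Set.InjOn ψ V := by
    intro x hx y hy h
    have h' : g x = g y := Rat.cast_injective (α := ℝ) h
    have := hg (x - y) (Finset.mem_union_right _ (Finset.sub_mem_sub hx hy)) (by simp [h'])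
    linarith
  have hiff : ∀ a ∈ V, ∀ b ∈ V, ∀ c ∈ V, (ψ a + ψ b = 2 * ψ c ↔ a + b = 2 * c) := by
    intro a ha b hb c hc
    have e : ψ a + ψ b = 2 * ψ c ↔ g ((a + b) - (c + c)) = 0 := by
      simp only [ψ, map_sub, map_add, sub_eq_zero, two_mul]
      norm_cast
    rw [e]
    constructor
    · intro h
      have := hg _ (Finset.mem_union_left _ (Finset.sub_mem_sub (Finset.add_mem_add ha hb)
        (Finset.add_mem_add hc hc))) h
      linarith
    · intro h
      have : a + b - (c + c) = 0 := by linarith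
      rw [this, map_zero]
  have hinjφ : Set.InjOn φ U := by
    intro x hx y hy h
    refine hinj (hUV x hx) (hUV y hy) ?_
    rw [← hφ x hx, ← hφ y hy, h]
  have hmap : ∀ S : Finset ℝ, (∀ s ∈ S, s ∈ U) → (S.image φ).map intCastEmb = S.image ψ := by
    intro S hS
    rw [Finset.map_eq_image, Finset.image_image]
    exact Finset.image_congr fun x hx => hφ x (hS x hx)
  have hneg : (-(A.image φ)).map intCastEmb = (-A).image ψ := by
    rw [Finset.map_eq_image, ← Finset.image_neg_eq_neg, ← Finset.image_neg_eq_neg,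
      Finset.image_image, Finset.image_image, Finset.image_image]
    refine Finset.image_congr fun x hx => ?_
    have := hφ x (hAU x hx)
    simp only [Function.comp, intCastEmb, Function.Embedding.coeFn_mk, Int.cast_neg, this]
    simp [ψ]
  refine ⟨A.image φ, B.image φ, Finset.card_image_of_injOn (hinjφ.mono hAU),
    Finset.card_image_of_injOn (hinjφ.mono hBU), ?_, ?_⟩
  · rw [← Finset.image_union, hmap A hAU, hmap B hBU, hmap _ (fun s hs => hs)]
    exact T_image _ _ _ ψ (hinj.mono fun x hx => hUV x (hAU x hx))
      (hinj.mono fun x hx => hUV x (hBU x hx)) (hinj.mono hUV)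
      fun a ha b hb c hc => hiff a (hUV a (hAU a ha)) b (hUV b (hBU b hb)) c (hUV c hc)
  · rw [hneg, hmap A hAU]
    exact T_image _ _ _ ψ (hinj.mono fun x hx => hUV x (hAU x hx))
      (hinj.mono hAV) (hinj.mono fun x hx => hUV x (hAU x hx))
      fun a ha b hb c hc => hiff a (hUV a (hAU a ha)) b (hAV b hb) c (hUV c (hAU c hc))
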